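/- arXiv:1908.02743 — 6 statements merged into one kernel-verified Lean document; each statement's English description precedes it below -/
import Mathlib

section
/- Let 𝒞 be a convexity space on a finite set V with hull operator ⟨·⟩. Let P be a finite set with |P| = n, let f be a natural number with n > 3f, and let F ⊆ P with |F| ≤ f. Let x : P → V, let P_i ⊆ P with |P_i| ≥ n − f, and let M_i : P → V satisfy M_i(j) = x(j) for every j ∈ P_i \ F. Define H_i = ⋂ { ⟨M_i[J]⟩ : J ⊆ P_i, |J| = |P_i| − f }, where M_i[J] = {M_i(j) : j ∈ J}. Then H_i ⊆ ⟨ x[P \ F] ⟩, where x[P \ F] = {x(j) : j ∈ P \ F}. -/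
/-- A convexity space on `V`: contains `∅` and `univ` and is closed under
binary intersections. -/
def IsConvexitySpace {V : Type*} (C : Set (Set V)) : Prop :=
  ∅ ∈ C ∧ Set.univ ∈ C ∧ ∀ A ∈ C, ∀ B ∈ C, A ∩ B ∈ C

/-- The convex hull: intersection of all convex sets containing `A`. -/
def cHull {V : Type*} (C : Set (Set V)) (A : Set V) : Set V :=
  ⋂₀ {K | K ∈ C ∧ A ⊆ K}

/-- the safe area `H_i` is contained in the hull of the
non-faulty processors' values. -/
theorem stmt1 {V P : Type*} [Fintype V] [Fintype P] [DecidableEq P]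
    (C : Set (Set V)) (hC : IsConvexitySpace C)
    (n f : ℕ) (hn : Fintype.card P = n) (hnf : n > 3 * f)
    (F : Set P) (hF : F.ncard ≤ f)
    (x : P → V)
    (Pi : Finset P) (hPi : n - f ≤ Pi.card)
    (Mi : P → V) (hM : ∀ j ∈ Pi, j ∉ F → Mi j = x j) :
    (⋂ J ∈ {J : Finset P | J ⊆ Pi ∧ J.card = Pi.card - f},
        cHull C (Mi '' (↑J : Set P)))
      ⊆ cHull C (x '' {j : P | j ∉ F}) := by
  classical
  have hcard : Pi.card - f ≤ (Pi \ F.toFinset).card := by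
    have h := Finset.le_card_sdiff F.toFinset Pi
    rw [← Set.ncard_eq_toFinset_card'] at h
    omega
  obtain ⟨J, hJ, hJcard⟩ := Finset.exists_subset_card_eq hcard
  rintro v hv K ⟨hKC, hK⟩
  have hvJ := Set.mem_iInter₂.1 hv J ⟨hJ.trans Finset.sdiff_subset, hJcard⟩
  refine hvJ K ⟨hKC, ?_⟩
  rintro _ ⟨j, hj, rfl⟩
  obtain ⟨hjP, hjF⟩ := Finset.mem_sdiff.1 (hJ hj)
  rw [Set.mem_toFinset] at hjF
  exact hM j hjP hjF ▸ hK ⟨j, hjF, rfl⟩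
end

section
/- Let 𝒞 be a convexity space on a finite set V and let A ∈ 𝒞 be a free convex set with |A| = m > 1. Then there exists a map μ : A × ⟨A⟩ → A such that (A, μ) is an m-blocking instance for 𝒞. -/
/-- The set of extreme points of `A`: elements `a ∈ A` with `a ∉ ⟨A \ {a}⟩`. -/
def exPoints {V : Type*} (C : Set (Set V)) (A : Set V) : Set V :=
  {a ∈ A | a ∉ cHull C (A \ {a})}

/-- `(A, μ)` is an `m`-blocking instance for `C`: `|A| = m`, `A = ex A`,
`μ` maps `A × ⟨A⟩` into `A`, and for all `x ∈ A`, `y ∈ ⟨A⟩` with `x ≠ y` we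
have `μ(x,y) ≠ x` and `y ∉ ⟨A \ {μ(x,y)}⟩`. -/
def IsBlockingInstance {V : Type*} (C : Set (Set V)) (A : Set V)
    (μ : V → V → V) (m : ℕ) : Prop :=
  A.ncard = m ∧
  A = exPoints C A ∧
  (∀ x ∈ A, ∀ y ∈ cHull C A, μ x y ∈ A) ∧
  (∀ x ∈ A, ∀ y ∈ cHull C A, x ≠ y → μ x y ≠ x) ∧
  (∀ x ∈ A, ∀ y ∈ cHull C A, x ≠ y → y ∉ cHull C (A \ {μ x y}))

/-- a free convex set `A` with `|A| = m > 1` yields an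
`m`-blocking instance. -/
theorem stmt6 {V : Type*} [Fintype V]
    (C : Set (Set V)) (hC : IsConvexitySpace C)
    (A : Set V) (hA : A ∈ C) (hfree : A = exPoints C A)
    (m : ℕ) (hm : A.ncard = m) (hm1 : 1 < m) :
    ∃ μ : V → V → V, IsBlockingInstance C A μ m := by
  have hull_subset : cHull C A ⊆ A := Set.sInter_subset_of_mem ⟨hA, subset_rfl⟩
  refine ⟨fun _ y => y, hm, hfree, fun _ _ _ hy => hull_subset hy,
    fun _ _ _ _ hxy => hxy.symm, fun _ _ y hy _ => ?_⟩
  have hy' : y ∈ exPoints C A := hfree ▸ hull_subset hy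
  exact hy'.2
end

section
/- Let 𝒞 be a convexity space on a finite set V. Then the following two conditions are equivalent: (i) every convex set K ∈ 𝒞 satisfies K = ⟨ex K⟩ (the Minkowski–Krein–Milman property); (ii) for every convex set K ∈ 𝒞 with K ≠ V there exists an element u ∈ V \ K such that K ∪ {u} ∈ 𝒞. -/
theorem subset_cHull {V : Type*} (C : Set (Set V)) (A : Set V) : A ⊆ cHull C A :=
  Set.subset_sInter fun _ hK => hK.2

theorem cHull_subset {V : Type*} {C : Set (Set V)} {A K : Set V} (hK : K ∈ C) (h : A ⊆ K) :
    cHull C A ⊆ K :=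
  Set.sInter_subset_of_mem ⟨hK, h⟩

theorem IsConvexitySpace.sInter_mem {V : Type*} {C : Set (Set V)} (hC : IsConvexitySpace C)
    {S : Set (Set V)} (hS : S.Finite) (hSC : S ⊆ C) : ⋂₀ S ∈ C := by
  induction S, hS using Set.Finite.induction_on with
  | empty => simpa using hC.2.1
  | insert _ _ ih =>
    rw [Set.sInter_insert]
    exact hC.2.2 _ (hSC (Set.mem_insert _ _)) _ (ih ((Set.subset_insert _ _).trans hSC))

theorem IsConvexitySpace.cHull_mem {V : Type*} [Finite V] {C : Set (Set V)}
    (hC : IsConvexitySpace C) (A : Set V) : cHull C A ∈ C :=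
  hC.sInter_mem (Set.toFinite _) fun _ hK => hK.1

/-- A point of a convex set is extreme exactly when removing it leaves a convex set. -/
theorem IsConvexitySpace.mem_exPoints_iff {V : Type*} [Finite V] {C : Set (Set V)}
    (hC : IsConvexitySpace C) {K : Set V} (hK : K ∈ C) {a : V} :
    a ∈ exPoints C K ↔ a ∈ K ∧ K \ {a} ∈ C := by
  refine and_congr_right fun _ => ⟨fun h => ?_, fun h h' => (cHull_subset h subset_rfl h').2 rfl⟩
  have heq : cHull C (K \ {a}) = K \ {a} :=
    (Set.subset_sdiff_singleton (cHull_subset hK Set.sdiff_subset) h).antisymm (subset_cHull C _)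
  exact heq ▸ hC.cHull_mem _

/-- the Minkowski–Krein–Milman property is equivalent to the
one-point extension property. -/
theorem stmt7 {V : Type*} [Fintype V]
    (C : Set (Set V)) (hC : IsConvexitySpace C) :
    (∀ K ∈ C, K = cHull C (exPoints C K)) ↔
    (∀ K ∈ C, K ≠ Set.univ → ∃ u ∈ Set.univ \ K, K ∪ {u} ∈ C) := by
  constructor
  · intro h K hK hKV
    obtain ⟨M, ⟨hM, hKM⟩, hmin⟩ := (Set.toFinite {M | M ∈ C ∧ K ⊂ M}).exists_minimal
      ⟨Set.univ, hC.2.1, Set.ssubset_univ_iff.2 hKV⟩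
    have hex : ¬ exPoints C M ⊆ K := fun hsub =>
      hKM.2 ((h M hM).subset.trans (cHull_subset hK hsub))
    obtain ⟨a, haM, haK⟩ := Set.not_subset.1 hex
    obtain ⟨ha, hMa⟩ := (hC.mem_exPoints_iff hM).1 haM
    have hKMa : K ⊆ M \ {a} := Set.subset_sdiff_singleton hKM.1 haK
    have hMaK : M \ {a} ⊆ K := by
      by_contra hn
      exact (hmin ⟨hMa, hKMa, hn⟩ Set.sdiff_subset ha).2 rfl
    refine ⟨a, ⟨trivial, haK⟩, ?_⟩
    rwa [hKMa.antisymm hMaK, Set.sdiff_union_of_subset (Set.singleton_subset_iff.2 ha)]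
  · intro h K hK
    refine Set.Subset.antisymm ?_ (cHull_subset hK fun _ ha => ha.1)
    by_contra hn
    obtain ⟨L, ⟨hL, hexL, hKL⟩, hmax⟩ :=
      (Set.toFinite {L | L ∈ C ∧ exPoints C K ⊆ L ∧ ¬ K ⊆ L}).exists_maximal
        ⟨_, hC.cHull_mem _, subset_cHull C _, hn⟩
    obtain ⟨u, ⟨-, huL⟩, hu⟩ := h L hL fun hLV => hKL (hLV ▸ Set.subset_univ K)
    have hKLu : K ⊆ L ∪ {u} := by
      by_contra hn'
      exact huL (hmax ⟨hu, hexL.trans Set.subset_union_left, hn'⟩ Set.subset_union_left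
        (Or.inr rfl))
    have hdiff : K \ {u} = K ∩ L := by
      ext x
      refine and_congr_right fun hx => ⟨fun hxu => (hKLu hx).resolve_right hxu, ?_⟩
      rintro hxL rfl
      exact huL hxL
    have huK : u ∈ K := by
      by_contra huK
      exact hKL fun x hx => (hKLu hx).resolve_right fun hxu => huK (hxu ▸ hx)
    exact huL (hexL ((hC.mem_exPoints_iff hK).2 ⟨huK, hdiff ▸ hC.2.2 K hK L hL⟩))
end

section
/- Let 𝒞 be a convexity space on a finite set V with Helly number at most ω (ω ≥ 1). Let P be a finite set with |P| = n and let f be a natural number with n > ωf. Let m : P → V and define H = ⋂ { ⟨m[J]⟩ : J ⊆ P, |J| = n − f }, where m[J] = {m(j) : j ∈ J}. Then H ≠ ∅, and moreover H ⊆ ⟨ m[P \ F] ⟩ for every F ⊆ P with |F| ≤ f. -/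
/-- `C` has Helly number at most `ω`: every finite subfamily of `C` in which
every `ω` members have a common element has nonempty intersection. -/
def HellyAtMost {V : Type*} (C : Set (Set V)) (ω : ℕ) : Prop :=
  ∀ 𝒜 : Finset (Set V), (↑𝒜 : Set (Set V)) ⊆ C →
    (∀ ℬ ⊆ 𝒜, ℬ.card ≤ ω → (⋂₀ (↑ℬ : Set (Set V))).Nonempty) →
    (⋂₀ (↑𝒜 : Set (Set V))).Nonempty

theorem cHull_mono {V : Type*} (C : Set (Set V)) {A B : Set V} (h : A ⊆ B) :
    cHull C A ⊆ cHull C B :=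
  Set.sInter_subset_sInter fun _ hK => ⟨hK.1, h.trans hK.2⟩

/-- Fewer than `|P| / f` sets whose complements have at most `f` elements share an element. -/
theorem exists_forall_mem_of_card_compl_le {ι P : Type*} [Fintype P] [DecidableEq P]
    (s : Finset ι) (J : ι → Finset P) (f : ℕ) (hJ : ∀ i ∈ s, (J i)ᶜ.card ≤ f)
    (h : s.card * f < Fintype.card P) : ∃ p, ∀ i ∈ s, p ∈ J i := by
  obtain ⟨p, -, hp⟩ := Finset.exists_mem_notMem_of_card_lt_card
    (s := s.biUnion fun i => (J i)ᶜ) (t := Finset.univ)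
    ((Finset.card_biUnion_le_card_mul s _ f hJ).trans_lt h)
  exact ⟨p, by simpa using hp⟩

/-- if `n > ωf` then the intersection
`H = ⋂ { ⟨m[J]⟩ : J ⊆ P, |J| = n − f }` is nonempty and contained in
`⟨ m[P \ F] ⟩` for every `F` with `|F| ≤ f`. -/
theorem stmt9 {V P : Type*} [Fintype V] [Fintype P] [DecidableEq P]
    (C : Set (Set V)) (hC : IsConvexitySpace C)
    (ω : ℕ) (hω : 1 ≤ ω) (hHelly : HellyAtMost C ω)
    (n f : ℕ) (hn : Fintype.card P = n) (hnf : n > ω * f)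
    (m : P → V) :
    (⋂ J ∈ {J : Finset P | J.card = n - f}, cHull C (m '' (↑J : Set P))).Nonempty ∧
    ∀ F : Finset P, F.card ≤ f →
      (⋂ J ∈ {J : Finset P | J.card = n - f}, cHull C (m '' (↑J : Set P)))
        ⊆ cHull C (m '' (↑(Finset.univ \ F) : Set P)) := by
  classical
  constructor
  · have : Nonempty P := Fintype.card_pos_iff.mp (by lia)
    let 𝒜 : Finset (Set V) := (Finset.univ.filter fun J : Finset P => J.card = n - f).image
      fun J : Finset P => cHull C (m '' (↑J : Set P))
    obtain ⟨x, hx⟩ := hHelly 𝒜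
      (by
        intro A hA
        obtain ⟨J, -, rfl⟩ := Finset.mem_image.mp (Finset.mem_coe.mp hA)
        exact hC.cHull_mem _)
      (by
        intro ℬ hℬ hcard
        have key : ∀ B ∈ ℬ, ∃ J : Finset P, J.card = n - f ∧ cHull C (m '' (↑J : Set P)) = B := by
          intro B hB
          simpa [𝒜] using hℬ hB
        choose! J hJcard hJ using key
        obtain ⟨p, hp⟩ := exists_forall_mem_of_card_compl_le ℬ J f
          (fun B hB => by rw [Finset.card_compl, hJcard B hB, hn]; lia)
          (by rw [hn]; exact (Nat.mul_le_mul_right f hcard).trans_lt hnf)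
        refine ⟨m p, fun B hB => ?_⟩
        rw [← hJ B hB]
        exact subset_cHull C _ (Set.mem_image_of_mem m (hp B hB)))
    refine ⟨x, Set.mem_iInter₂.mpr fun J hJ => hx _ ?_⟩
    exact Finset.mem_coe.mpr
      (Finset.mem_image_of_mem _ (Finset.mem_filter.mpr ⟨Finset.mem_univ J, hJ⟩))
  · intro F hF
    obtain ⟨J, hJF, hJ⟩ := Finset.exists_subset_card_eq (s := Finset.univ \ F) (n := n - f)
      (by rw [← Finset.compl_eq_univ_sdiff, Finset.card_compl, hn]; lia)
    exact Set.Subset.trans (Set.biInter_subset_of_mem hJ)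
      (cHull_mono C (Set.image_mono (Finset.coe_subset.mpr hJF)))
end

section
/- Let G be a finite tree and let H₁, H₂ be nonempty monophonically convex (i.e., subtree-inducing) vertex sets with H₁ ∩ H₂ ≠ ∅. If y₁ ∈ cent(H₁) and y₂ ∈ cent(H₂), then d(y₁, y₂) ≤ R(H₁ ∪ H₂) + 1. -/
open SimpleGraph

/-- A walk is a chordless (induced/minimal) path: it is a path and any two of
its vertices adjacent in `G` are adjacent along the walk itself. -/
def IsChordlessPath {V : Type*} {G : SimpleGraph V} {u v : V}
    (p : G.Walk u v) : Prop :=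
  p.IsPath ∧ ∀ a ∈ p.support, ∀ b ∈ p.support, G.Adj a b → p.toSubgraph.Adj a b

/-- A vertex set is monophonically convex: it contains every vertex of every
chordless path between two of its members. -/
def MonoConvex {V : Type*} (G : SimpleGraph V) (U : Set V) : Prop :=
  ∀ u ∈ U, ∀ v ∈ U, ∀ p : G.Walk u v, IsChordlessPath p →
    ∀ w ∈ p.support, w ∈ U

/-- Eccentricity of `u` within the vertex set `S` (distances in `G`). -/
noncomputable def eccIn {V : Type*} (G : SimpleGraph V) (S : Finset V) (u : V) : ℕ :=
  S.sup (fun v => G.dist u v)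

/-- Radius of the vertex set `S`: minimum eccentricity over members of `S`. -/
noncomputable def radiusIn {V : Type*} (G : SimpleGraph V) (S : Finset V) : ℕ :=
  sInf ((fun u => eccIn G S u) '' (↑S : Set V))

/-- Center of the vertex set `S`: its members of minimum eccentricity. -/
noncomputable def centIn {V : Type*} (G : SimpleGraph V) (S : Finset V) : Set V :=
  {u ∈ (↑S : Set V) | ∀ v ∈ S, eccIn G S u ≤ eccIn G S v}

namespace SimpleGraph

variable {V : Type*} {G : SimpleGraph V}

lemma Walk.eq_add_one_of_adj_getVert {u v : V} {p : G.Walk u v}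
    (hp : p.length = G.dist u v) {i j : ℕ} (hij : i ≤ j) (hj : j ≤ p.length)
    (h : G.Adj (p.getVert i) (p.getVert j)) : j = i + 1 := by
  have hne : i ≠ j := by
    rintro rfl
    exact h.ne rfl
  have hle := dist_le ((p.take i).append (cons h (p.drop j)))
  simp only [length_append, length_cons, take_length, drop_length] at hle
  omega

lemma Walk.toSubgraph_adj_of_length_eq_dist {u v : V} {p : G.Walk u v}
    (hp : p.length = G.dist u v) {i j : ℕ} (hij : i ≤ j) (hj : j ≤ p.length)
    (h : G.Adj (p.getVert i) (p.getVert j)) :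
    p.toSubgraph.Adj (p.getVert i) (p.getVert j) := by
  obtain rfl := eq_add_one_of_adj_getVert hp hij hj h
  exact p.toSubgraph_adj_getVert (by omega)

lemma Walk.isChordlessPath_of_length_eq_dist {u v : V} {p : G.Walk u v}
    (hp : p.length = G.dist u v) : IsChordlessPath p := by
  refine ⟨p.isPath_of_length_eq_dist hp, fun a ha b hb hab => ?_⟩
  obtain ⟨i, rfl, hi⟩ := mem_support_iff_exists_getVert.mp ha
  obtain ⟨j, rfl, hj⟩ := mem_support_iff_exists_getVert.mp hb
  rcases le_total i j with hij | hij
  · exact toSubgraph_adj_of_length_eq_dist hp hij hj hab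
  · exact (toSubgraph_adj_of_length_eq_dist hp hij hi hab.symm).symm

lemma IsTree.length_eq_dist_of_isPath (hG : G.IsTree) {u v : V} {p : G.Walk u v}
    (hp : p.IsPath) : p.length = G.dist u v := by
  obtain ⟨q, hq, hlen⟩ := hG.connected.exists_path_of_dist u v
  rw [← hlen, (hG.existsUnique_path u v).unique hp hq]

/-- In a tree, if `ab` is an edge with `v` on the side of `a` and `w` on the side of `b`,
then the geodesic from `v` to `w` crosses `ab`. -/
lemma IsTree.dist_eq_of_adj_of_dist (hG : G.IsTree) {a b v w : V} (hab : G.Adj a b)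
    (hv : G.dist v b = G.dist v a + 1) (hw : G.dist a w = G.dist b w + 1) :
    G.dist v w = G.dist v a + G.dist a w := by
  obtain ⟨p, hp⟩ := hG.connected.exists_walk_length_eq_dist v a
  obtain ⟨q, hq⟩ := hG.connected.exists_walk_length_eq_dist b w
  have hp' : (p.concat hab).IsPath :=
    Walk.isPath_of_length_eq_dist _ (by rw [Walk.length_concat, hp, hv])
  have hq' : (Walk.cons hab q).IsPath :=
    Walk.isPath_of_length_eq_dist _ (by rw [Walk.length_cons, hq, hw])
  have hpq : (p.append (Walk.cons hab q)).IsPath := by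
    rw [hG.isAcyclic.isPath_iff_isChain] at hp' hq' ⊢
    rw [Walk.edges_concat, List.concat_eq_append] at hp'
    rw [Walk.edges_cons] at hq'
    rw [Walk.edges_append, Walk.edges_cons]
    exact List.isChain_split.mpr ⟨hp', hq'⟩
  have := hG.length_eq_dist_of_isPath hpq
  rw [Walk.length_append, Walk.length_cons] at this
  omega

lemma Connected.exists_adj_dist_eq_add_one (hG : G.Connected) {u v : V} (h : u ≠ v) :
    ∃ w, G.Adj u w ∧ G.dist u v = G.dist w v + 1 := by
  obtain ⟨p, hp⟩ := hG.exists_walk_length_eq_dist u v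
  cases p with
  | nil => exact absurd rfl h
  | @cons _ w _ hadj q =>
    refine ⟨w, hadj, ?_⟩
    have h₁ := dist_le q
    have h₂ := hG.dist_triangle (u := u) (v := w) (w := v)
    rw [dist_eq_one_iff_adj.mpr hadj] at h₂
    rw [Walk.length_cons] at hp
    omega

end SimpleGraph

lemma MonoConvex.mem_of_adj_of_dist {V : Type*} {G : SimpleGraph V} {U : Set V}
    (hU : MonoConvex G U) {u v w : V} (hu : u ∈ U) (hv : v ∈ U) (hG : G.Connected)
    (hadj : G.Adj u w) (hd : G.dist u v = G.dist w v + 1) : w ∈ U := by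
  obtain ⟨q, hq⟩ := hG.exists_walk_length_eq_dist w v
  refine hU u hu v hv (Walk.cons hadj q)
    (Walk.isChordlessPath_of_length_eq_dist (by rw [Walk.length_cons, hq, hd])) w ?_
  simp

lemma exists_mem_dist_eq_eccIn {V : Type*} (G : SimpleGraph V) {S : Finset V}
    (hS : S.Nonempty) (u : V) : ∃ v ∈ S, G.dist u v = eccIn G S u := by
  obtain ⟨v, hv, h⟩ := S.exists_mem_eq_sup hS (fun v => G.dist u v)
  exact ⟨v, hv, h.symm⟩

lemma dist_le_eccIn {V : Type*} (G : SimpleGraph V) {S : Finset V} (u : V) {v : V}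
    (hv : v ∈ S) : G.dist u v ≤ eccIn G S u :=
  Finset.le_sup (f := fun v => G.dist u v) hv

/-- From any vertex `w`, some vertex of `S` lies beyond the center vertex `y`
at distance at least `R(S) - 1` from `y`. -/
lemma exists_mem_dist_add_eccIn_le {V : Type*} {G : SimpleGraph V} (hG : G.IsTree)
    {S : Finset V} (hc : MonoConvex G (↑S : Set V)) {y : V} (hy : y ∈ centIn G S) (w : V) :
    ∃ v ∈ S, G.dist w y + eccIn G S y ≤ G.dist w v + 1 := by
  obtain ⟨hyS, hmin⟩ := hy
  have hne : S.Nonempty := ⟨y, hyS⟩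
  by_cases hyw : y = w
  · subst hyw
    obtain ⟨v, hv, h⟩ := exists_mem_dist_eq_eccIn G hne y
    exact ⟨v, hv, by rw [dist_self]; omega⟩
  obtain ⟨y', hadj, hd⟩ := hG.connected.exists_adj_dist_eq_add_one hyw
  have key : ∀ v, G.dist v y' = G.dist v y + 1 → G.dist w v = G.dist w y + G.dist y v := by
    intro v hv
    have := hG.dist_eq_of_adj_of_dist hadj hv hd
    rw [dist_comm (u := w), dist_comm (u := w), dist_comm (u := y) (v := v)]
    omega
  by_cases hy' : y' ∈ S
  · obtain ⟨v, hv, h⟩ := exists_mem_dist_eq_eccIn G hne y'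
    have h₁ := hmin y' hy'
    have h₂ := dist_le_eccIn G y hv
    refine ⟨v, hv, ?_⟩
    rw [dist_comm] at h
    rw [dist_comm] at h₂
    rcases hG.dist_eq_dist_add_one_of_adj v hadj with h₃ | h₃
    · omega
    · have h₄ := key v h₃
      rw [dist_comm (u := y)] at h₄
      omega
  · obtain ⟨v, hv, h⟩ := exists_mem_dist_eq_eccIn G hne y
    refine ⟨v, hv, ?_⟩
    rcases hG.dist_eq_dist_add_one_of_adj v hadj with h₃ | h₃
    · rw [dist_comm, dist_comm (u := v)] at h₃
      exact absurd (hc.mem_of_adj_of_dist hyS hv hG.connected hadj h₃) hy'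
    · have h₄ := key v h₃
      omega

lemma dist_le_two_mul_radiusIn {V : Type*} {G : SimpleGraph V} (hG : G.Connected)
    {S : Finset V} {u v : V} (hu : u ∈ S) (hv : v ∈ S) :
    G.dist u v ≤ 2 * radiusIn G S := by
  obtain ⟨c, -, hcr⟩ := Nat.sInf_mem
    (s := (fun u => eccIn G S u) '' (↑S : Set V)) ⟨_, u, hu, rfl⟩
  have hcr : eccIn G S c = radiusIn G S := hcr
  have h₁ := dist_le_eccIn G c hu
  have h₂ := dist_le_eccIn G c hv
  have h₃ := hG.dist_triangle (u := u) (v := c) (w := v)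
  rw [dist_comm (u := u) (v := c)] at h₃
  omega

/-- in a finite tree, if `H₁, H₂` are nonempty intersecting
monophonically convex sets and `yᵢ ∈ cent(Hᵢ)`, then
`d(y₁, y₂) ≤ R(H₁ ∪ H₂) + 1`. -/
theorem stmt10 {V : Type*} [Fintype V] [DecidableEq V]
    (G : SimpleGraph V) (hG : G.IsTree)
    (H₁ H₂ : Finset V) (h1 : H₁.Nonempty) (h2 : H₂.Nonempty)
    (hc1 : MonoConvex G (↑H₁ : Set V)) (hc2 : MonoConvex G (↑H₂ : Set V))
    (hint : (H₁ ∩ H₂).Nonempty)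
    (y₁ y₂ : V) (hy1 : y₁ ∈ centIn G H₁) (hy2 : y₂ ∈ centIn G H₂) :
    G.dist y₁ y₂ ≤ radiusIn G (H₁ ∪ H₂) + 1 := by
  obtain ⟨x, hx⟩ := hint
  rw [Finset.mem_inter] at hx
  obtain ⟨v₂, hv₂, hd₂⟩ := exists_mem_dist_add_eccIn_le hG hc2 hy2 y₁
  obtain ⟨v₁, hv₁, hd₁⟩ := exists_mem_dist_add_eccIn_le hG hc1 hy1 v₂
  have hR := dist_le_two_mul_radiusIn hG.connected
    (Finset.mem_union_right H₁ hv₂) (Finset.mem_union_left H₂ hv₁)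
  have hx₁ := dist_le_eccIn G y₁ hx.1
  have hx₂ := dist_le_eccIn G y₂ hx.2
  have htri := hG.connected.dist_triangle (u := y₁) (v := x) (w := y₂)
  rw [dist_comm (u := x)] at htri
  rw [dist_comm (u := v₂) (v := y₁)] at hd₁
  omega
end

section
/- Let G be a finite graph and let (T, χ) be a tree decomposition of G in which every bag χ(b) is a clique in G. Then G has a tree decomposition (T', χ') with |V(T')| = 2|V(T)| − 1 such that every bag χ'(b') is a clique in G and for every edge {a,b} of T' either χ'(a) ⊆ χ'(b) or χ'(b) ⊆ χ'(a) (that is, (T', χ') is expanded). -/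
open SimpleGraph

/-- `(T, χ)` is a tree decomposition of `G`: `T` is a tree, every vertex of
`G` lies in some bag, every edge of `G` is contained in some bag, and for each
vertex `v` of `G`, the bags containing `v` form a subtree (equivalently, if
`v ∈ χ a ∩ χ b` then `v` belongs to every bag on the unique path from `a` to
`b` in `T`). -/
def IsTreeDecomp {V B : Type*} (G : SimpleGraph V) (T : SimpleGraph B)
    (χ : B → Set V) : Prop :=
  T.IsTree ∧
  (∀ v : V, ∃ b : B, v ∈ χ b) ∧
  (∀ u v : V, G.Adj u v → ∃ b : B, u ∈ χ b ∧ v ∈ χ b) ∧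
  (∀ (v : V) (a b : B), v ∈ χ a → v ∈ χ b →
    ∀ p : T.Walk a b, p.IsPath → ∀ c ∈ p.support, v ∈ χ c)

namespace SimpleGraph

/-- The subdivision of a graph: every edge is replaced by a path of length two through a new
vertex. -/
def subdivision {B : Type*} (T : SimpleGraph B) : SimpleGraph (B ⊕ T.edgeSet) where
  Adj
    | .inl b, .inr e => b ∈ e.1
    | .inr e, .inl b => b ∈ e.1
    | _, _ => False
  symm := ⟨by rintro (a | e) (b | f) h <;> exact h⟩
  loopless := ⟨by rintro (a | e) h <;> exact h⟩

variable {B : Type*} {T : SimpleGraph B}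

lemma subdivision_adj_inl_inr {b : B} {e : T.edgeSet} :
    T.subdivision.Adj (.inl b) (.inr e) ↔ b ∈ e.1 := Iff.rfl

lemma subdivision_adj_inr_inl {b : B} {e : T.edgeSet} :
    T.subdivision.Adj (.inr e) (.inl b) ↔ b ∈ e.1 := Iff.rfl

lemma Walk.exists_subdivision_walk {a b : B} (p : T.Walk a b) :
    ∃ q : T.subdivision.Walk (.inl a) (.inl b), ∀ x ∈ q.support,
      (∃ c ∈ p.support, x = .inl c) ∨ ∃ e : T.edgeSet, e.1 ∈ p.edges ∧ x = .inr e := by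
  induction p with
  | nil => exact ⟨.nil, by simp⟩
  | @cons a c b h p ih =>
    obtain ⟨q, hq⟩ := ih
    let e : T.edgeSet := ⟨s(a, c), h⟩
    have h₁ : T.subdivision.Adj (.inl a) (.inr e) := Sym2.mem_mk_left a c
    have h₂ : T.subdivision.Adj (.inr e) (.inl c) := Sym2.mem_mk_right a c
    refine ⟨.cons h₁ (.cons h₂ q), fun x hx => ?_⟩
    simp only [Walk.support_cons, List.mem_cons] at hx
    rcases hx with rfl | rfl | hx
    · exact .inl ⟨a, by simp, rfl⟩
    · exact .inr ⟨e, by simp [e], rfl⟩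
    · rcases hq x hx with ⟨c, hc, rfl⟩ | ⟨e, he, rfl⟩
      · exact .inl ⟨c, by simp [hc], rfl⟩
      · exact .inr ⟨e, by simp [he], rfl⟩

lemma Connected.subdivision (hT : T.Connected) : T.subdivision.Connected := by
  obtain ⟨r⟩ := hT.nonempty
  have hl (b : B) : T.subdivision.Reachable (.inl r) (.inl b) := by
    obtain ⟨p⟩ := hT.preconnected r b
    exact p.exists_subdivision_walk.choose.reachable
  refine connected_iff_exists_forall_reachable _ |>.2 ⟨.inl r, ?_⟩
  rintro (b | ⟨e, he⟩)
  · exact hl b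
  · induction e with | _ a b =>
    exact (hl a).trans (Adj.reachable (Sym2.mem_mk_left a b))

lemma card_edgeSet_subdivision_le [Finite B] :
    Nat.card T.subdivision.edgeSet ≤ 2 * Nat.card T.edgeSet := by
  classical
  have := Fintype.ofFinite B
  let f : T.Dart → T.subdivision.edgeSet := fun d =>
    ⟨s(.inl d.fst, .inr ⟨d.edge, d.edge_mem⟩), Sym2.mem_mk_left d.fst d.snd⟩
  have key (b : B) (e : T.edgeSet) (h : b ∈ e.1) :
      ∃ d, (f d).1 = s(.inl b, .inr e) := by
    obtain ⟨e, he⟩ := e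
    obtain ⟨c, rfl⟩ := h
    exact ⟨⟨(b, c), he⟩, rfl⟩
  have hf : Function.Surjective f := by
    rintro ⟨x, hx⟩
    induction x with | _ x y =>
    rcases x with b | e <;> rcases y with c | e'
    · exact hx.elim
    · obtain ⟨d, hd⟩ := key b e' hx
      exact ⟨d, Subtype.ext hd⟩
    · obtain ⟨d, hd⟩ := key c e hx
      exact ⟨d, Subtype.ext (hd.trans Sym2.eq_swap)⟩
    · exact hx.elim
  calc _ ≤ Nat.card T.Dart := Nat.card_le_card_of_surjective f hf
    _ = _ := by
      rw [Nat.card_eq_fintype_card, dart_card_eq_twice_card_edges, edgeFinset_card,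
        Nat.card_eq_fintype_card]

lemma IsTree.card_edgeSet_add_one [Finite B] (hT : T.IsTree) :
    Nat.card T.edgeSet + 1 = Nat.card B :=
  (isTree_iff_connected_and_card.1 hT).2

lemma IsTree.card_sum_edgeSet [Finite B] (hT : T.IsTree) :
    Nat.card (B ⊕ T.edgeSet) = 2 * Nat.card B - 1 := by
  have := hT.card_edgeSet_add_one
  rw [Nat.card_sum]
  omega

lemma IsTree.subdivision [Finite B] (hT : T.IsTree) : T.subdivision.IsTree := by
  refine isTree_iff_connected_and_card.2 ⟨hT.connected.subdivision, ?_⟩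
  have h₁ := hT.card_edgeSet_add_one
  have h₂ := T.card_edgeSet_subdivision_le
  have h₃ := hT.connected.subdivision.card_vert_le_card_edgeSet_add_one
  rw [Nat.card_sum] at *
  omega

lemma IsAcyclic.support_subset_of_isPath {a b : B} (hT : T.IsAcyclic) {p : T.Walk a b}
    (hp : p.IsPath) (q : T.Walk a b) : p.support ⊆ q.support := by
  classical
  have : p = q.bypass :=
    congrArg Subtype.val
      ((hT.subsingleton_path a b).elim ⟨p, hp⟩ ⟨q.bypass, q.bypass_isPath⟩)
  exact this ▸ q.support_bypass_subset_support

end SimpleGraph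

section TreeDecomposition

variable {V B B' : Type*} {G : SimpleGraph V} {T : SimpleGraph B} {χ : B → Set V}

/-- The bags on the subdivision of a tree: a subdividing node carries the intersection of the
bags at the ends of its edge. -/
def subdivisionBag (T : SimpleGraph B) (χ : B → Set V) : B ⊕ T.edgeSet → Set V :=
  Sum.elim χ fun e => {v | ∀ b ∈ e.1, v ∈ χ b}

lemma exists_walk_subdivision_of_mem_subdivisionBag {v : V} {x : B ⊕ T.edgeSet}
    (hx : v ∈ subdivisionBag T χ x) :
    ∃ b, v ∈ χ b ∧ ∃ q : T.subdivision.Walk (.inl b) x,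
      ∀ y ∈ q.support, v ∈ subdivisionBag T χ y := by
  rcases x with b | ⟨e, he⟩
  · exact ⟨b, hx, .nil, by simpa using hx⟩
  · induction e with | _ a b =>
    have ha : v ∈ χ a := hx a (Sym2.mem_mk_left a b)
    have h : T.subdivision.Adj (.inl a) (.inr ⟨s(a, b), he⟩) := Sym2.mem_mk_left a b
    refine ⟨a, ha, .cons h .nil, fun y hy => ?_⟩
    simp only [Walk.support_cons, Walk.support_nil, List.mem_cons, List.not_mem_nil,
      or_false] at hy
    rcases hy with rfl | rfl
    · exact ha
    · exact hx

lemma IsTreeDecomp.exists_walk_subdivision (h : IsTreeDecomp G T χ) {v : V} {a b : B}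
    (ha : v ∈ χ a) (hb : v ∈ χ b) :
    ∃ q : T.subdivision.Walk (.inl a) (.inl b),
      ∀ y ∈ q.support, v ∈ subdivisionBag T χ y := by
  obtain ⟨hT, -, -, hpath⟩ := h
  obtain ⟨p, hp⟩ := (hT.connected a b).exists_isPath
  obtain ⟨q, hq⟩ := p.exists_subdivision_walk
  refine ⟨q, fun y hy => ?_⟩
  rcases hq y hy with ⟨c, hc, rfl⟩ | ⟨e, he, rfl⟩
  · exact hpath v a b ha hb p hp c hc
  · exact fun c hc => hpath v a b ha hb p hp c (p.mem_support_of_mem_edges he hc)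

lemma IsTreeDecomp.subdivision [Finite B] (h : IsTreeDecomp G T χ) :
    IsTreeDecomp G T.subdivision (subdivisionBag T χ) := by
  refine ⟨h.1.subdivision, fun v => ?_, fun u v huv => ?_, fun v x y hx hy p hp => ?_⟩
  · obtain ⟨b, hb⟩ := h.2.1 v
    exact ⟨.inl b, hb⟩
  · obtain ⟨b, hb⟩ := h.2.2.1 u v huv
    exact ⟨.inl b, hb⟩
  · obtain ⟨a, ha, q, hq⟩ := exists_walk_subdivision_of_mem_subdivisionBag hx
    obtain ⟨b, hb, r, hr⟩ := exists_walk_subdivision_of_mem_subdivisionBag hy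
    obtain ⟨s, hs⟩ := h.exists_walk_subdivision ha hb
    intro c hc
    have := h.1.subdivision.isAcyclic.support_subset_of_isPath hp
      (q.reverse.append (s.append r)) hc
    simp only [Walk.mem_support_append_iff, Walk.support_reverse, List.mem_reverse] at this
    rcases this with hc | hc | hc
    · exact hq c hc
    · exact hs c hc
    · exact hr c hc

lemma IsTreeDecomp.of_iso {T' : SimpleGraph B'} (h : IsTreeDecomp G T χ) (f : T' ≃g T) :
    IsTreeDecomp G T' (χ ∘ f) := by
  obtain ⟨hT, hV, hE, hpath⟩ := h
  refine ⟨f.isTree_iff.2 hT, fun v => ?_, fun u v huv => ?_, fun v a b ha hb p hp c hc => ?_⟩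
  · obtain ⟨b, hb⟩ := hV v
    exact ⟨f.symm b, by simpa using hb⟩
  · obtain ⟨b, hb⟩ := hE u v huv
    exact ⟨f.symm b, by simpa using hb⟩
  · refine hpath v _ _ ha hb (p.map f.toHom) (hp.map f.injective) _ ?_
    rw [Walk.support_map]
    exact List.mem_map_of_mem hc

lemma isClique_subdivisionBag (hχ : ∀ b, G.IsClique (χ b)) (x : B ⊕ T.edgeSet) :
    G.IsClique (subdivisionBag T χ x) := by
  rcases x with b | ⟨e, he⟩
  · exact hχ b
  · induction e with | _ a b =>
    exact (hχ a).subset fun v hv => hv a (Sym2.mem_mk_left a b)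

lemma subdivisionBag_subset_or_subset {x y : B ⊕ T.edgeSet} (h : T.subdivision.Adj x y) :
    subdivisionBag T χ x ⊆ subdivisionBag T χ y ∨
      subdivisionBag T χ y ⊆ subdivisionBag T χ x := by
  rcases x with a | e <;> rcases y with b | f
  · exact h.elim
  · exact .inr fun v hv => hv a h
  · exact .inl fun v hv => hv b h
  · exact h.elim

end TreeDecomposition

/-- from a tree decomposition all of whose bags are cliques one
obtains an *expanded* tree decomposition with `2|V(T)| − 1` nodes, all of
whose bags are cliques, in which along every tree edge one bag contains the
other. -/
theorem stmt13 {V B : Type*} [Fintype V] [Fintype B]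
    (G : SimpleGraph V) (T : SimpleGraph B) (χ : B → Set V)
    (hTD : IsTreeDecomp G T χ) (hclique : ∀ b : B, G.IsClique (χ b)) :
    ∃ (T' : SimpleGraph (Fin (2 * Fintype.card B - 1)))
      (χ' : Fin (2 * Fintype.card B - 1) → Set V),
      IsTreeDecomp G T' χ' ∧
      (∀ b, G.IsClique (χ' b)) ∧
      (∀ a b, T'.Adj a b → χ' a ⊆ χ' b ∨ χ' b ⊆ χ' a) := by
  have hcard : Nat.card (B ⊕ T.edgeSet) = 2 * Fintype.card B - 1 := by
    rw [← Nat.card_eq_fintype_card, hTD.1.card_sum_edgeSet]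
  let φ := (Finite.equivFinOfCardEq hcard).symm
  let f := Iso.comap φ T.subdivision
  exact ⟨T.subdivision.comap φ, subdivisionBag T χ ∘ φ, hTD.subdivision.of_iso f,
    fun b => isClique_subdivisionBag hclique (φ b),
    fun a b hab => subdivisionBag_subset_or_subset hab⟩
end
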